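/- Restriction (trace) lemma on a boost end: Let n ≥ 2, θ ∈ (0,1/2], λ ≥ 2, R > 0, and let V_{θ,λ} = {(x̄,t) ∈ ℝ^{n−1}×ℝ : |t| < θσ̄(x̄) and |x̄| ≥ R + λ|t|}, where σ̄(x̄) = (1+|x̄|²)^{1/2}. Let s ∈ ℕ and δ ∈ ℝ. There exists a constant C, depending only on n, θ, λ, R, s, δ, such that for every τ ∈ (−θ, θ) and every smooth u on V_{θ,λ} with ‖u‖_{H_{s+1,δ}(V_{θ,λ})} < ∞, one has Σ_{k=0}^{s} ‖ x̄ ↦ (∂_t^k u)(x̄, τσ̄(x̄)) ‖²_{H_{s−k, δ+1/2+k}(E′_τ)} ≤ C ‖u‖²_{H_{s+1,δ}(V_{θ,λ})}, where E′_τ = {x̄ ∈ ℝ^{n−1} : |x̄| ≥ R + λ|τ|σ̄(x̄)} is the projection of the slice {t = τσ̄(x̄)} ∩ V_{θ,λ}. -/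

import Mathlib

open MeasureTheory

/-- The boost end `V_{θ,λ} = {(x̄,t) ∈ ℝᵐ×ℝ : |t| < θσ̄(x̄), |x̄| ≥ R + λ|t|}`,
where `σ̄(x̄) = (1+|x̄|²)^{1/2}`. -/
def boostEnd (m : ℕ) (θ lam R : ℝ) : Set (EuclideanSpace ℝ (Fin m) × ℝ) :=
  {p | |p.2| < θ * Real.sqrt (1 + ‖p.1‖ ^ 2) ∧ R + lam * |p.2| ≤ ‖p.1‖}

/-- The projection `E′_τ = {x̄ ∈ ℝᵐ : |x̄| ≥ R + λ|τ|σ̄(x̄)}` of the slice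
`{t = τσ̄(x̄)} ∩ V_{θ,λ}`. -/
def endSlice (m : ℕ) (lam R τ : ℝ) : Set (EuclideanSpace ℝ (Fin m)) :=
  {x | R + lam * |τ| * Real.sqrt (1 + ‖x‖ ^ 2) ≤ ‖x‖}

/-- The weighted Sobolev norm on a set `U ⊆ ℝᵐ×ℝ`, valued in `ℝ≥0∞`, with weight in the
spatial variable only. -/
noncomputable def wSobOn (m s : ℕ) (δ : ℝ) (U : Set (EuclideanSpace ℝ (Fin m) × ℝ))
    (u : EuclideanSpace ℝ (Fin m) × ℝ → ℝ) : ENNReal :=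
  (∑ k ∈ Finset.range (s + 1),
    ∫⁻ p in U,
      ENNReal.ofReal ((1 + ‖p.1‖ ^ 2) ^ (δ + (k : ℝ)) * ‖iteratedFDeriv ℝ k u p‖ ^ 2)) ^ (1/2 : ℝ)

/-- The weighted Sobolev norm of a spatial function on a set `U ⊆ ℝᵐ`, valued in `ℝ≥0∞`. -/
noncomputable def wSobE (m s : ℕ) (δ : ℝ) (U : Set (EuclideanSpace ℝ (Fin m)))
    (v : EuclideanSpace ℝ (Fin m) → ℝ) : ENNReal :=
  (∑ k ∈ Finset.range (s + 1),
    ∫⁻ x in U,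
      ENNReal.ofReal ((1 + ‖x‖ ^ 2) ^ (δ + (k : ℝ)) * ‖iteratedFDeriv ℝ k v x‖ ^ 2)) ^ (1/2 : ℝ)

/-- The partial derivative `∂_t` in the time (second) variable. -/
noncomputable def timeDeriv {m : ℕ} (u : EuclideanSpace ℝ (Fin m) × ℝ → ℝ) :
    EuclideanSpace ℝ (Fin m) × ℝ → ℝ :=
  fun p => deriv (fun t => u (p.1, t)) p.2


theorem norm_iteratedFDeriv_clm_le {E F : Type*} [NormedAddCommGroup E] [NormedSpace ℝ E]
    [NormedAddCommGroup F] [NormedSpace ℝ F] (L : E →L[ℝ] F) (x : E) {a b : ℝ}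
    (ha : ‖L x‖ ≤ a) (hb : 0 ≤ b) (hL : ‖L‖ ≤ a * b) (i : ℕ) :
    ‖iteratedFDeriv ℝ i L x‖ ≤ a * b ^ i := by
  have ha0 : 0 ≤ a := (norm_nonneg _).trans ha
  match i with
  | 0 => simpa using ha
  | 1 =>
    rw [← norm_iteratedFDeriv_fderiv, norm_iteratedFDeriv_zero, L.fderiv]
    simpa using hL
  | j + 2 =>
    rw [← norm_iteratedFDeriv_fderiv]
    have : fderiv ℝ L = fun _ => L := by ext1 y; exact L.fderiv
    rw [this, iteratedFDeriv_const_of_ne (by simp)]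
    simp only [Pi.zero_apply, norm_zero]
    positivity

theorem one_le_japanese {E : Type*} [NormedAddCommGroup E] (x : E) :
    1 ≤ Real.sqrt (1 + ‖x‖ ^ 2) := by
  rw [Real.one_le_sqrt]
  nlinarith [sq_nonneg ‖x‖]

theorem norm_le_japanese {E : Type*} [NormedAddCommGroup E] (x : E) :
    ‖x‖ ≤ Real.sqrt (1 + ‖x‖ ^ 2) :=
  Real.le_sqrt_of_sq_le (by linarith)

theorem contDiff_japanese {E : Type*} [NormedAddCommGroup E] [InnerProductSpace ℝ E]
    {N : WithTop ℕ∞} : ContDiff ℝ N (fun x : E => Real.sqrt (1 + ‖x‖ ^ 2)) :=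
  (contDiff_const.add (contDiff_norm_sq ℝ)).sqrt fun x => by positivity

theorem norm_iteratedFDeriv_norm_sq_le {E : Type*} [NormedAddCommGroup E] [InnerProductSpace ℝ E]
    (x : E) {ρ : ℝ} (hρ : 0 < ρ) (hx : ‖x‖ ≤ ρ) (i : ℕ) (hi : 1 ≤ i) :
    ‖iteratedFDeriv ℝ i (fun y : E => ρ⁻¹ ^ 2 * (1 + ‖y‖ ^ 2)) x‖ ≤ (2 / ρ) ^ i := by
  obtain ⟨j, rfl⟩ : ∃ j, i = j + 1 := ⟨i - 1, by omega⟩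
  obtain ⟨L, hL, hLapp⟩ : ∃ L : E →L[ℝ] (E →L[ℝ] ℝ), ‖L‖ ≤ ρ⁻¹ ^ 2 * 2 ∧
      ∀ y z, L y z = ρ⁻¹ ^ 2 * 2 * inner ℝ y z :=
    ⟨LinearMap.mkContinuous₂ ((ρ⁻¹ ^ 2 * 2) • innerₗ E) (ρ⁻¹ ^ 2 * 2) fun y z => by
      have h := norm_inner_le_norm (𝕜 := ℝ) y z
      rw [LinearMap.smul_apply, LinearMap.smul_apply, innerₗ_apply_apply, norm_smul,
        Real.norm_of_nonneg (by positivity), mul_assoc _ ‖y‖]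
      gcongr, LinearMap.mkContinuous₂_norm_le _ (by positivity) _, fun y z => rfl⟩
  have hfd : fderiv ℝ (fun y : E => ρ⁻¹ ^ 2 * (1 + ‖y‖ ^ 2)) = L := by
    ext1 y
    have h := ((hasStrictFDerivAt_norm_sq y).hasFDerivAt.const_add 1).const_mul (ρ⁻¹ ^ 2)
    rw [h.fderiv]
    ext z
    simp [hLapp]
    ring
  rw [← norm_iteratedFDeriv_fderiv, hfd]
  refine (norm_iteratedFDeriv_clm_le L x (a := 2 / ρ) (b := 2 / ρ) ?_ (by positivity) ?_ j).trans ?_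
  · calc ‖L x‖ ≤ (ρ⁻¹ ^ 2 * 2) * ρ := (L.le_opNorm x).trans (by gcongr)
      _ = 2 / ρ := by field_simp
  · refine hL.trans ?_
    have : (2 / ρ) * (2 / ρ) = ρ⁻¹ ^ 2 * 4 := by field_simp; norm_num
    rw [this]; gcongr; norm_num
  · rw [pow_succ']

/-- Derivatives of the Japanese bracket satisfy symbol estimates of order one. -/
theorem exists_norm_iteratedFDeriv_japanese_le (E : Type*) [NormedAddCommGroup E]
    [InnerProductSpace ℝ E] (i : ℕ) :
    ∃ C : ℝ, 0 ≤ C ∧ ∀ x : E,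
      ‖iteratedFDeriv ℝ i (fun y : E => Real.sqrt (1 + ‖y‖ ^ 2)) x‖ ≤
        C * Real.sqrt (1 + ‖x‖ ^ 2) * (Real.sqrt (1 + ‖x‖ ^ 2))⁻¹ ^ i := by
  set K : ℝ := ∑ j ∈ Finset.range (i + 1), ‖iteratedFDerivWithin ℝ j Real.sqrt (Set.Ioi 0) 1‖
  have hK : 0 ≤ K := Finset.sum_nonneg fun _ _ => norm_nonneg _
  refine ⟨i.factorial * K * 2 ^ i, by positivity, fun x => ?_⟩
  set ρ := Real.sqrt (1 + ‖x‖ ^ 2) with hρdef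
  have hρ : 0 < ρ := zero_lt_one.trans_le (one_le_japanese x)
  have hρ2 : ρ ^ 2 = 1 + ‖x‖ ^ 2 := Real.sq_sqrt (by positivity)
  have hq : ContDiff ℝ i (fun y : E => ρ⁻¹ ^ 2 * (1 + ‖y‖ ^ 2)) :=
    contDiff_const.mul (contDiff_const.add (contDiff_norm_sq ℝ))
  have hfun : (fun y : E => Real.sqrt (1 + ‖y‖ ^ 2)) =
      ρ • (Real.sqrt ∘ fun y : E => ρ⁻¹ ^ 2 * (1 + ‖y‖ ^ 2)) := by
    ext1 y
    simp only [Pi.smul_apply, Function.comp_apply, smul_eq_mul]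
    rw [Real.sqrt_mul (by positivity), Real.sqrt_sq (by positivity)]
    field_simp
  have hpos : ∀ y : E, 0 < ρ⁻¹ ^ 2 * (1 + ‖y‖ ^ 2) := fun y => by positivity
  have hx1 : ρ⁻¹ ^ 2 * (1 + ‖x‖ ^ 2) = 1 := by rw [← hρ2]; field_simp
  have hmain : ‖iteratedFDeriv ℝ i (Real.sqrt ∘ fun y : E => ρ⁻¹ ^ 2 * (1 + ‖y‖ ^ 2)) x‖ ≤
      i.factorial * K * (2 / ρ) ^ i := by
    refine norm_iteratedFDeriv_comp_le' (t := Set.Ioi 0) (N := i) ?_ (uniqueDiffOn_Ioi 0) ?_ hq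
      le_rfl x ?_ ?_
    · rintro _ ⟨y, rfl⟩; exact hpos y
    · exact fun y hy => (Real.contDiffAt_sqrt (ne_of_gt hy)).contDiffWithinAt
    · intro j hj
      rw [hx1]
      exact Finset.single_le_sum
        (f := fun j => ‖iteratedFDerivWithin ℝ j Real.sqrt (Set.Ioi 0) 1‖)
        (fun _ _ => norm_nonneg _) (Finset.mem_range.2 (by omega))
    · exact fun j hj _ => norm_iteratedFDeriv_norm_sq_le x hρ (norm_le_japanese x) j hj
  have hsq : ContDiff ℝ i (Real.sqrt ∘ fun y : E => ρ⁻¹ ^ 2 * (1 + ‖y‖ ^ 2)) :=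
    hq.sqrt fun y => (hpos y).ne'
  rw [hfun, iteratedFDeriv_const_smul_apply hsq.contDiffAt, norm_smul, Real.norm_of_nonneg hρ.le]
  refine (mul_le_mul_of_nonneg_left hmain hρ.le).trans_eq ?_
  rw [div_pow, inv_pow]
  ring

/-- Weighted chain rule for the restriction of a function to the graph `t = τσ̄(x)`. -/
theorem exists_norm_iteratedFDeriv_graph_le (E : Type*) [NormedAddCommGroup E]
    [InnerProductSpace ℝ E] (l : ℕ) :
    ∃ C : ℝ, 0 ≤ C ∧ ∀ τ : ℝ, |τ| ≤ 1 → ∀ w : E × ℝ → ℝ, ContDiff ℝ (⊤ : ℕ∞) w → ∀ x : E,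
      ‖iteratedFDeriv ℝ l (fun y : E => w (y, τ * Real.sqrt (1 + ‖y‖ ^ 2))) x‖ ≤
        C * (Real.sqrt (1 + ‖x‖ ^ 2))⁻¹ ^ l * ∑ i ∈ Finset.range (l + 1),
          Real.sqrt (1 + ‖x‖ ^ 2) ^ i *
            ‖iteratedFDeriv ℝ i w (x, τ * Real.sqrt (1 + ‖x‖ ^ 2))‖ := by
  choose A hA0 hA using exists_norm_iteratedFDeriv_japanese_le E
  set D : ℝ := 1 + ∑ i ∈ Finset.range (l + 1), A i with hD
  have hD1 : 1 ≤ D := le_add_of_nonneg_right (Finset.sum_nonneg fun i _ => hA0 i)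
  refine ⟨l.factorial * D ^ l, by positivity, fun τ hτ w hw x => ?_⟩
  set ρ := Real.sqrt (1 + ‖x‖ ^ 2) with hρdef
  have hρ : 0 < ρ := zero_lt_one.trans_le (one_le_japanese x)
  set g : E × ℝ → ℝ := fun p => w (ρ • p)
  set h : E → E × ℝ := fun y => (y, τ * Real.sqrt (1 + ‖y‖ ^ 2)) with hh
  have hhs : ContDiff ℝ (⊤ : ℕ∞) h := contDiff_id.prodMk (contDiff_const.mul contDiff_japanese)
  set f : E → E × ℝ := ρ⁻¹ • h with hf
  have hfs : ContDiff ℝ (⊤ : ℕ∞) f := hhs.const_smul ρ⁻¹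
  have hgs : ContDiff ℝ (⊤ : ℕ∞) g := hw.comp (contDiff_const_smul ρ)
  have hfun : (fun y : E => w (y, τ * Real.sqrt (1 + ‖y‖ ^ 2))) = g ∘ f := by
    ext1 y
    simp only [g, f, Function.comp_apply, Pi.smul_apply, smul_smul, mul_inv_cancel₀ hρ.ne',
      one_smul, h]
  have hhD : ∀ i, 1 ≤ i → i ≤ l → ‖iteratedFDeriv ℝ i f x‖ ≤ (D * ρ⁻¹) ^ i := by
    intro i hi1 hil
    have hsplit : h = (ContinuousLinearMap.inl ℝ E ℝ : E → E × ℝ) +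
        (τ • ContinuousLinearMap.inr ℝ E ℝ) ∘ fun y : E => Real.sqrt (1 + ‖y‖ ^ 2) := by
      ext1 y
      simp [h]
    have hs1 : ‖iteratedFDeriv ℝ i (ContinuousLinearMap.inl ℝ E ℝ) x‖ ≤ ρ * ρ⁻¹ ^ i := by
      refine norm_iteratedFDeriv_clm_le _ x ?_ (by positivity) ?_ i
      · simpa using norm_le_japanese x
      · rw [mul_inv_cancel₀ hρ.ne']
        exact ContinuousLinearMap.opNorm_le_bound _ zero_le_one fun y => by simp
    have hs2 : ‖iteratedFDeriv ℝ i ((τ • ContinuousLinearMap.inr ℝ E ℝ) ∘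
        fun y : E => Real.sqrt (1 + ‖y‖ ^ 2)) x‖ ≤ A i * ρ * ρ⁻¹ ^ i := by
      refine (ContinuousLinearMap.norm_iteratedFDeriv_comp_left (τ • ContinuousLinearMap.inr ℝ E ℝ)
        (N := (⊤ : ℕ∞)) contDiff_japanese.contDiffAt (by exact_mod_cast le_top)).trans ?_
      have : ‖τ • ContinuousLinearMap.inr ℝ E ℝ‖ ≤ 1 :=
        ContinuousLinearMap.opNorm_le_bound _ zero_le_one fun y => by
          simp
          exact mul_le_of_le_one_left (abs_nonneg _) hτ
      exact (mul_le_of_le_one_left (norm_nonneg _) this).trans (hA i x)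
    have hAD : 1 + A i ≤ D := by
      rw [hD]
      gcongr
      exact Finset.single_le_sum (f := A) (fun j _ => hA0 j) (Finset.mem_range.2 (by omega))
    have hDi : D ≤ D ^ i := le_self_pow₀ hD1 (by omega)
    rw [hf, iteratedFDeriv_const_smul_apply (hhs.of_le (by exact_mod_cast le_top)).contDiffAt,
      norm_smul, Real.norm_of_nonneg (by positivity), hsplit, iteratedFDeriv_add_apply
        (ContinuousLinearMap.contDiff _).contDiffAt
        ((ContinuousLinearMap.contDiff _).comp contDiff_japanese).contDiffAt]
    calc ρ⁻¹ * ‖_‖ ≤ ρ⁻¹ * (ρ * ρ⁻¹ ^ i + A i * ρ * ρ⁻¹ ^ i) := by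
          gcongr
          exact (norm_add_le _ _).trans (add_le_add hs1 hs2)
      _ = (1 + A i) * ρ⁻¹ ^ i := by field_simp
      _ ≤ D ^ i * ρ⁻¹ ^ i := by gcongr; exact hAD.trans hDi
      _ = (D * ρ⁻¹) ^ i := (mul_pow _ _ _).symm
  have hgD : ∀ i, i ≤ l → ‖iteratedFDeriv ℝ i g (f x)‖ ≤
      ∑ i ∈ Finset.range (l + 1), ρ ^ i * ‖iteratedFDeriv ℝ i w (h x)‖ := by
    intro i hi
    have : iteratedFDeriv ℝ i g (f x) = ρ ^ i • iteratedFDeriv ℝ i w (h x) := by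
      have := iteratedFDeriv_comp_const_smul (𝕜 := ℝ) (i := i) ρ (f := w)
        (hw.of_le (by exact_mod_cast le_top))
      rw [show g = fun p => w (ρ • p) from rfl, this]
      simp [f, smul_smul, mul_inv_cancel₀ hρ.ne']
    rw [this, norm_smul, Real.norm_of_nonneg (by positivity)]
    exact Finset.single_le_sum (f := fun i => ρ ^ i * ‖iteratedFDeriv ℝ i w (h x)‖)
      (fun _ _ => by positivity) (Finset.mem_range.2 (by omega))
  rw [hfun]
  refine (norm_iteratedFDeriv_comp_le hgs hfs (by exact_mod_cast le_top) x hgD hhD).trans_eq ?_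
  rw [mul_pow]
  ring

theorem timeDeriv_iterate_spec {m : ℕ} (u : EuclideanSpace ℝ (Fin m) × ℝ → ℝ)
    (hu : ContDiff ℝ (⊤ : ℕ∞) u) (k : ℕ) :
    ContDiff ℝ (⊤ : ℕ∞) ((timeDeriv (m := m))^[k] u) ∧
      ∀ (j : ℕ) (p : EuclideanSpace ℝ (Fin m) × ℝ), ‖iteratedFDeriv ℝ j ((timeDeriv (m := m))^[k] u) p‖ ≤ ‖iteratedFDeriv ℝ (j + k) u p‖ := by
  induction k with
  | zero => exact ⟨hu, fun j p => le_rfl⟩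
  | succ k ih =>
    obtain ⟨hs, hb⟩ := ih
    rw [Function.iterate_succ_apply']
    set w := (timeDeriv (m := m))^[k] u
    set L := ContinuousLinearMap.apply ℝ ℝ ((0, 1) : EuclideanSpace ℝ (Fin m) × ℝ)
    have hfd : ContDiff ℝ (⊤ : ℕ∞) (fderiv ℝ w) := hs.fderiv_right (by simp)
    have hfun : timeDeriv w = L ∘ fderiv ℝ w := by
      ext1 p
      have h1 : HasDerivAt (fun t : ℝ => (p.1, t)) ((0, 1) : EuclideanSpace ℝ (Fin m) × ℝ) p.2 :=
        (hasDerivAt_const _ _).prodMk (hasDerivAt_id _)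
      have h2 : HasFDerivAt w (fderiv ℝ w p) (p.1, p.2) :=
        (hs.differentiable (by simp) p).hasFDerivAt
      exact (h2.comp_hasDerivAt p.2 h1).deriv
    rw [hfun]
    refine ⟨L.contDiff.comp hfd, fun j p => ?_⟩
    refine (L.norm_iteratedFDeriv_comp_left (N := (⊤ : ℕ∞)) hfd.contDiffAt
      (by exact_mod_cast le_top)).trans ?_
    have hL : ‖L‖ ≤ 1 := ContinuousLinearMap.opNorm_le_bound _ zero_le_one fun T => by
      refine (T.le_opNorm _).trans ?_
      simp [Prod.norm_def]
    refine (mul_le_of_le_one_left (norm_nonneg _) hL).trans ?_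
    rw [norm_iteratedFDeriv_fderiv, show j + (k + 1) = j + 1 + k by ring]
    exact hb _ p

theorem sq_intervalIntegral_le {ψ : ℝ → ℝ} (hψ : Continuous ψ) {L : ℝ} (hL : 0 < L) :
    (∫ s in (0 : ℝ)..L, ψ s) ^ 2 ≤ L * ∫ s in (0 : ℝ)..L, ψ s ^ 2 := by
  set I := ∫ s in (0 : ℝ)..L, ψ s
  have h0 : 0 ≤ ∫ s in (0 : ℝ)..L, (L * ψ s - I) ^ 2 :=
    intervalIntegral.integral_nonneg hL.le fun s _ => sq_nonneg _
  have h1 : ∫ s in (0 : ℝ)..L, (L * ψ s - I) ^ 2 =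
      L ^ 2 * (∫ s in (0 : ℝ)..L, ψ s ^ 2) - 2 * L * I * I + L * I ^ 2 := by
    have : ∀ s, (L * ψ s - I) ^ 2 = L ^ 2 * ψ s ^ 2 - 2 * L * I * ψ s + I ^ 2 := fun s => by ring
    simp_rw [this]
    rw [intervalIntegral.integral_add (Continuous.intervalIntegrable (by fun_prop) _ _)
      (Continuous.intervalIntegrable (by fun_prop) _ _),
      intervalIntegral.integral_sub (Continuous.intervalIntegrable (by fun_prop) _ _)
      (Continuous.intervalIntegrable (by fun_prop) _ _),
      intervalIntegral.integral_const_mul, intervalIntegral.integral_const_mul]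
    simp [I]
  rw [h1] at h0
  have h2 : 0 ≤ L * (L * (∫ s in (0 : ℝ)..L, ψ s ^ 2) - I ^ 2) := by linarith
  have := nonneg_of_mul_nonneg_right h2 hL
  linarith

/-- One-dimensional trace inequality. -/
theorem norm_sq_le_intervalIntegral {F : Type*} [NormedAddCommGroup F] [NormedSpace ℝ F]
    [CompleteSpace F] {g g' : ℝ → F} {L : ℝ} (hL : 0 < L) (hg : ∀ s, HasDerivAt g (g' s) s)
    (hg' : Continuous g') :
    ‖g 0‖ ^ 2 ≤ ∫ s in (0 : ℝ)..L, (2 / L * ‖g s‖ ^ 2 + 2 * L * ‖g' s‖ ^ 2) := by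
  have hgc : Continuous g := continuous_iff_continuousAt.2 fun s => (hg s).continuousAt
  have hφ : ∀ s, HasDerivAt (fun s => (L - s) • g s) ((L - s) • g' s + (-1 : ℝ) • g s) s :=
    fun s => ((hasDerivAt_id s).const_sub L).smul (hg s)
  have hint := intervalIntegral.integral_eq_sub_of_hasDerivAt (a := 0) (b := L)
    (fun s _ => hφ s) (Continuous.intervalIntegrable (by fun_prop) _ _)
  have h1 : L * ‖g 0‖ ≤ ∫ s in (0 : ℝ)..L, (L * ‖g' s‖ + ‖g s‖) := by
    calc L * ‖g 0‖ = ‖∫ s in (0 : ℝ)..L, ((L - s) • g' s + (-1 : ℝ) • g s)‖ := by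
          rw [hint]
          simp [norm_smul, abs_of_pos hL]
      _ ≤ ∫ s in (0 : ℝ)..L, ‖(L - s) • g' s + (-1 : ℝ) • g s‖ :=
          intervalIntegral.norm_integral_le_integral_norm hL.le
      _ ≤ _ := by
          refine intervalIntegral.integral_mono_on hL.le
            (Continuous.intervalIntegrable (by fun_prop) _ _)
            (Continuous.intervalIntegrable (by fun_prop) _ _) fun s hs => ?_
          refine (norm_add_le _ _).trans ?_
          simp only [norm_smul, Real.norm_eq_abs, abs_neg, abs_one, one_mul]
          gcongr
          rw [abs_of_nonneg (by linarith [hs.2])]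
          linarith [hs.1]
  have h2 := sq_intervalIntegral_le (ψ := fun s => L * ‖g' s‖ + ‖g s‖) (by fun_prop) hL
  have h3 : ∫ s in (0 : ℝ)..L, (L * ‖g' s‖ + ‖g s‖) ^ 2 ≤
      ∫ s in (0 : ℝ)..L, L * (2 / L * ‖g s‖ ^ 2 + 2 * L * ‖g' s‖ ^ 2) := by
    refine intervalIntegral.integral_mono_on hL.le
      (Continuous.intervalIntegrable (by fun_prop) _ _)
      (Continuous.intervalIntegrable (by fun_prop) _ _) fun s _ => ?_
    have : L * (2 / L * ‖g s‖ ^ 2 + 2 * L * ‖g' s‖ ^ 2) =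
        2 * ‖g s‖ ^ 2 + 2 * (L * ‖g' s‖) ^ 2 := by field_simp
    rw [this]
    nlinarith [sq_nonneg (L * ‖g' s‖ - ‖g s‖)]
  rw [intervalIntegral.integral_const_mul] at h3
  have h4 : (L * ‖g 0‖) ^ 2 ≤ (∫ s in (0 : ℝ)..L, (L * ‖g' s‖ + ‖g s‖)) ^ 2 := by gcongr
  have h5 := h4.trans (h2.trans (mul_le_mul_of_nonneg_left h3 hL.le))
  refine le_of_mul_le_mul_left ?_ (pow_pos hL 2)
  linarith

theorem lintegral_comp_smul_eq {E : Type*} [NormedAddCommGroup E] [NormedSpace ℝ E]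
    [MeasurableSpace E] [BorelSpace E] [FiniteDimensional ℝ E] (μ : Measure E)
    [μ.IsAddHaarMeasure] {f : E → ENNReal} (hf : Measurable f) {c : ℝ} (hc : c ≠ 0) :
    ∫⁻ x, f (c • x) ∂μ = ENNReal.ofReal |(c ^ Module.finrank ℝ E)⁻¹| * ∫⁻ x, f x ∂μ := by
  rw [← lintegral_map hf (measurable_const_smul c), Measure.map_addHaar_smul μ hc,
    lintegral_smul_measure, smul_eq_mul]

/-- Change of variables along the family of rescaled slices
`(x, s) ↦ ((1 + a s) x, (τ - η s) σ̄((1 + a s) x))`. -/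
theorem lintegral_rescaled_slices_le {m : ℕ} {G : EuclideanSpace ℝ (Fin m) × ℝ → ENNReal}
    (hG : Measurable G) {a L τ η : ℝ} (ha : 0 ≤ a) (hη : |η| = 1) :
    ∫⁻ x, ∫⁻ s in Set.Ioc 0 L,
        G ((1 + a * s) • x, (τ - η * s) * Real.sqrt (1 + ‖(1 + a * s) • x‖ ^ 2)) ≤
      ∫⁻ p, G p * ENNReal.ofReal (Real.sqrt (1 + ‖p.1‖ ^ 2))⁻¹ := by
  have hη0 : η ≠ 0 := by rintro rfl; simp at hη
  rw [lintegral_lintegral_swap]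
  swap
  · refine Measurable.aemeasurable (hG.comp (Continuous.measurable ?_))
    fun_prop
  calc ∫⁻ s in Set.Ioc 0 L, ∫⁻ x,
        G ((1 + a * s) • x, (τ - η * s) * Real.sqrt (1 + ‖(1 + a * s) • x‖ ^ 2))
      ≤ ∫⁻ s in Set.Ioc 0 L, ∫⁻ y : EuclideanSpace ℝ (Fin m),
          G (y, (τ - η * s) * Real.sqrt (1 + ‖y‖ ^ 2)) := by
        refine setLIntegral_mono' measurableSet_Ioc fun s hs => ?_
        have h1 : 1 ≤ 1 + a * s := le_add_of_nonneg_right (mul_nonneg ha hs.1.le)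
        rw [lintegral_comp_smul_eq volume
          (f := fun y => G (y, (τ - η * s) * Real.sqrt (1 + ‖y‖ ^ 2)))
          (hG.comp (Continuous.measurable (by fun_prop))) (by positivity)]
        refine mul_le_of_le_one_left zero_le ?_
        rw [ENNReal.ofReal_le_one, abs_of_nonneg (by positivity)]
        exact inv_le_one_of_one_le₀ (one_le_pow₀ h1)
    _ ≤ ∫⁻ s, ∫⁻ y : EuclideanSpace ℝ (Fin m),
          G (y, (τ - η * s) * Real.sqrt (1 + ‖y‖ ^ 2)) := setLIntegral_le_lintegral _ _
    _ = ∫⁻ y : EuclideanSpace ℝ (Fin m), ∫⁻ s,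
          G (y, (τ - η * s) * Real.sqrt (1 + ‖y‖ ^ 2)) := by
        rw [lintegral_lintegral_swap]
        exact Measurable.aemeasurable (hG.comp (Continuous.measurable (by fun_prop)))
    _ = ∫⁻ y : EuclideanSpace ℝ (Fin m), ∫⁻ t,
          G (y, t) * ENNReal.ofReal (Real.sqrt (1 + ‖y‖ ^ 2))⁻¹ := by
        refine lintegral_congr fun y => ?_
        set ρ := Real.sqrt (1 + ‖y‖ ^ 2)
        have hρ : 0 < ρ := zero_lt_one.trans_le (one_le_japanese y)
        have hGy : Measurable fun t : ℝ => G (y, t) := hG.comp (by fun_prop)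
        have h := lintegral_comp_smul_eq volume (f := fun t : ℝ => G (y, τ * ρ + t))
          (hG.comp (by fun_prop)) (c := -(η * ρ)) (neg_ne_zero.2 (mul_ne_zero hη0 hρ.ne'))
        rw [lintegral_add_left_eq_self (μ := volume) (fun t => G (y, t)) (τ * ρ)] at h
        rw [lintegral_mul_const _ hGy, mul_comm]
        convert h using 3
        · congr 2
          simp only [smul_eq_mul]
          ring
        · simp [abs_inv, abs_mul, hη, abs_of_pos hρ]
    _ = _ := by
        rw [Measure.volume_eq_prod, lintegral_prod]
        refine (hG.mul ?_).aemeasurable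
        exact ENNReal.measurable_ofReal.comp
          (Continuous.measurable (Continuous.inv₀ (by fun_prop) fun p =>
            (zero_lt_one.trans_le (one_le_japanese p.1)).ne'))

theorem japanese_smul_le {E : Type*} [NormedAddCommGroup E] [NormedSpace ℝ E] {c : ℝ}
    (hc : 1 ≤ c) (x : E) : Real.sqrt (1 + ‖c • x‖ ^ 2) ≤ c * Real.sqrt (1 + ‖x‖ ^ 2) := by
  have hc0 : 0 ≤ c := zero_le_one.trans hc
  rw [norm_smul, Real.norm_of_nonneg hc0, ← Real.sqrt_sq hc0, ← Real.sqrt_mul (sq_nonneg c),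
    Real.sqrt_sq hc0]
  refine Real.sqrt_le_sqrt ?_
  nlinarith [one_le_pow₀ (n := 2) hc]

theorem japanese_le_smul {E : Type*} [NormedAddCommGroup E] [NormedSpace ℝ E] {c : ℝ}
    (hc : 1 ≤ c) (x : E) : Real.sqrt (1 + ‖x‖ ^ 2) ≤ Real.sqrt (1 + ‖c • x‖ ^ 2) := by
  rw [norm_smul, Real.norm_of_nonneg (zero_le_one.trans hc)]
  gcongr
  exact le_mul_of_one_le_left (norm_nonneg x) hc

/-- The rescaled slices stay inside the boost end. -/
theorem rescaled_slice_mem_boostEnd {m : ℕ} {θ lam R τ η s : ℝ} {x : EuclideanSpace ℝ (Fin m)}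
    (hlam : 0 < lam) (hR : 0 < R) (hτ : |τ| < θ) (hη : |τ - η * s| = |(|τ| - s)|)
    (hs : 0 < s) (hsθ : s < θ) (hs1 : 2 * lam * (1 + 1 / R) * s ≤ 1)
    (hx : x ∈ endSlice m lam R τ) :
    ((1 + 2 * lam * (1 + 1 / R) * s) • x,
      (τ - η * s) * Real.sqrt (1 + ‖(1 + 2 * lam * (1 + 1 / R) * s) • x‖ ^ 2)) ∈
      boostEnd m θ lam R := by
  set c := 1 + 2 * lam * (1 + 1 / R) * s with hc
  have hc1 : 1 ≤ c := le_add_of_nonneg_right (by positivity)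
  have hσ := japanese_smul_le hc1 x
  have hσ1 := one_le_japanese x
  have hy1 := one_le_japanese (c • x)
  have hx' : R + lam * |τ| * Real.sqrt (1 + ‖x‖ ^ 2) ≤ ‖x‖ := hx
  set ρ := Real.sqrt (1 + ‖x‖ ^ 2) with hρ
  set ρ' := Real.sqrt (1 + ‖c • x‖ ^ 2)
  have hRx : R ≤ ‖x‖ := by
    have : 0 ≤ lam * |τ| * ρ := by positivity
    linarith
  have habs : |(τ - η * s) * ρ'| = |(|τ| - s)| * ρ' := by
    rw [abs_mul, hη, abs_of_pos (by linarith : 0 < ρ')]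
  simp only [boostEnd, Set.mem_ofPred_eq]
  rw [habs]
  have hnorm : ‖c • x‖ = c * ‖x‖ := by rw [norm_smul, Real.norm_of_nonneg (by linarith)]
  constructor
  · gcongr
    rw [abs_lt]
    constructor <;> linarith [abs_nonneg τ]
  · rw [hnorm]
    rcases le_total s |τ| with h | h
    · rw [abs_of_nonneg (by linarith)]
      have h1 : (|τ| - s) * ρ' ≤ |τ| * (c * ρ) := by gcongr; linarith
      have h2 : c * (R + lam * |τ| * ρ) ≤ c * ‖x‖ := by gcongr
      have h3 : lam * ((|τ| - s) * ρ') ≤ lam * (|τ| * (c * ρ)) := by gcongr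
      nlinarith
    · rw [abs_of_nonpos (by linarith)]
      have hρx : ρ ≤ (1 + 1 / R) * ‖x‖ := by
        have h1 : ρ ≤ 1 + ‖x‖ := Real.sqrt_le_iff.2 ⟨by positivity, by nlinarith [norm_nonneg x]⟩
        have h2 : 1 ≤ 1 / R * ‖x‖ := by rw [one_div, inv_mul_eq_div, one_le_div hR]; exact hRx
        linarith
      have h1 : -(|τ| - s) * ρ' ≤ s * (2 * ((1 + 1 / R) * ‖x‖)) := by
        have : ρ' ≤ 2 * ((1 + 1 / R) * ‖x‖) := hσ.trans (by gcongr; linarith)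
        have : -(|τ| - s) ≤ s := by linarith [abs_nonneg τ]
        gcongr
      have h2 : lam * (-(|τ| - s) * ρ') ≤ lam * (s * (2 * ((1 + 1 / R) * ‖x‖))) := by gcongr
      have h3 : c * ‖x‖ = ‖x‖ + lam * (s * (2 * ((1 + 1 / R) * ‖x‖))) := by rw [hc]; ring
      linarith

theorem rpow_le_four_rpow_mul {p q : ℝ} (hp : 0 < p) (hpq : p ≤ q) (hq : q ≤ 4 * p) (e : ℝ) :
    p ^ e ≤ 4 ^ |e| * q ^ e := by
  have hq0 : 0 < q := hp.trans_le hpq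
  rcases le_total 0 e with he | he
  · calc p ^ e ≤ q ^ e := Real.rpow_le_rpow hp.le hpq he
      _ ≤ _ := le_mul_of_one_le_left (by positivity)
        (Real.one_le_rpow (by norm_num) (abs_nonneg e))
  · rw [abs_of_nonpos he]
    have h := Real.rpow_le_rpow_of_nonpos hq0 hq he
    rw [Real.mul_rpow (by norm_num) hp.le] at h
    calc p ^ e = 4 ^ (-e) * (4 ^ e * p ^ e) := by
          rw [← mul_assoc, ← Real.rpow_add (by norm_num)]; simp
      _ ≤ _ := by gcongr

theorem hasDerivAt_rescaled_slice {E : Type*} [NormedAddCommGroup E] [InnerProductSpace ℝ E]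
    (x : E) (a τ η s : ℝ) :
    HasDerivAt (fun s : ℝ => ((1 + a * s) • x,
        (τ - η * s) * Real.sqrt (1 + ‖(1 + a * s) • x‖ ^ 2)))
      (a • x, -η * Real.sqrt (1 + ‖(1 + a * s) • x‖ ^ 2) + (τ - η * s) *
        (a * ((1 + a * s) * ‖x‖ ^ 2) / Real.sqrt (1 + ‖(1 + a * s) • x‖ ^ 2))) s := by
  have hlin : HasDerivAt (fun s : ℝ => 1 + a * s) a s := by
    simpa using ((hasDerivAt_id s).const_mul a).const_add 1
  have hτ : HasDerivAt (fun s : ℝ => τ - η * s) (-η) s := by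
    simpa using ((hasDerivAt_id s).const_mul η).const_sub τ
  have hsq : ∀ s : ℝ, 1 + ‖(1 + a * s) • x‖ ^ 2 = 1 + (1 + a * s) ^ 2 * ‖x‖ ^ 2 := fun s => by
    rw [norm_smul, mul_pow, Real.norm_eq_abs, sq_abs]
  simp_rw [hsq]
  refine (hlin.smul_const x).prodMk ?_
  have hpow : HasDerivAt (fun s : ℝ => (1 + a * s) ^ 2) (2 * (1 + a * s) * a) s := by
    simpa using hlin.fun_pow 2
  have h := ((hpow.mul_const (‖x‖ ^ 2)).const_add 1).sqrt
    (by positivity : 1 + (1 + a * s) ^ 2 * ‖x‖ ^ 2 ≠ 0)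
  refine (hτ.fun_mul h).congr_deriv ?_
  field_simp

theorem norm_deriv_rescaled_slice_le {E : Type*} [NormedAddCommGroup E] [InnerProductSpace ℝ E]
    (x : E) {a τ η s : ℝ} (ha : 0 ≤ a) (hs : 0 ≤ s) (has : a * s ≤ 1) (hη : |η| = 1)
    (hτ : |τ - η * s| ≤ 1) :
    ‖(a • x, -η * Real.sqrt (1 + ‖(1 + a * s) • x‖ ^ 2) + (τ - η * s) *
        (a * ((1 + a * s) * ‖x‖ ^ 2) / Real.sqrt (1 + ‖(1 + a * s) • x‖ ^ 2)))‖ ≤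
      (2 + a) * Real.sqrt (1 + ‖x‖ ^ 2) := by
  have hc : 1 ≤ 1 + a * s := le_add_of_nonneg_right (by positivity)
  have hσ := japanese_smul_le hc x
  have hy := norm_le_japanese ((1 + a * s) • x)
  have hy1 := one_le_japanese ((1 + a * s) • x)
  have hx := norm_le_japanese x
  have hx1 := one_le_japanese x
  set ρ' := Real.sqrt (1 + ‖(1 + a * s) • x‖ ^ 2)
  set ρ := Real.sqrt (1 + ‖x‖ ^ 2)
  rw [norm_smul, Real.norm_of_nonneg (by linarith)] at hy
  have hax : a * ‖x‖ ≤ a * ρ := by gcongr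
  rw [Prod.norm_def, max_le_iff]
  constructor
  · rw [norm_smul, Real.norm_of_nonneg ha]
    linarith
  · refine (norm_add_le _ _).trans ?_
    have h1 : ‖-η * ρ'‖ ≤ 2 * ρ := by
      rw [norm_mul, norm_neg, Real.norm_eq_abs, hη, Real.norm_of_nonneg (by linarith), one_mul]
      exact hσ.trans (by gcongr; linarith)
    have h2 : ‖(τ - η * s) * (a * ((1 + a * s) * ‖x‖ ^ 2) / ρ')‖ ≤ a * ‖x‖ := by
      rw [norm_mul, Real.norm_eq_abs, Real.norm_of_nonneg (by positivity)]
      refine (mul_le_of_le_one_left (by positivity) hτ).trans ?_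
      rw [div_le_iff₀ (by linarith)]
      calc a * ((1 + a * s) * ‖x‖ ^ 2) = a * ‖x‖ * ((1 + a * s) * ‖x‖) := by ring
        _ ≤ a * ‖x‖ * ρ' := by gcongr
    linarith

theorem measurableSet_boostEnd (m : ℕ) (θ lam R : ℝ) : MeasurableSet (boostEnd m θ lam R) :=
  by
  have h1 : MeasurableSet {p : EuclideanSpace ℝ (Fin m) × ℝ |
      |p.2| < θ * Real.sqrt (1 + ‖p.1‖ ^ 2)} :=
    measurableSet_lt (Continuous.measurable (by fun_prop)) (Continuous.measurable (by fun_prop))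
  have h2 : MeasurableSet {p : EuclideanSpace ℝ (Fin m) × ℝ | R + lam * |p.2| ≤ ‖p.1‖} :=
    measurableSet_le (Continuous.measurable (by fun_prop)) (Continuous.measurable (by fun_prop))
  exact h1.inter h2

theorem measurableSet_endSlice (m : ℕ) (lam R τ : ℝ) : MeasurableSet (endSlice m lam R τ) :=
  measurableSet_le (by fun_prop) (by fun_prop)

theorem continuous_weight {E : Type*} [NormedAddCommGroup E] (e : ℝ) :
    Continuous fun p : E × ℝ => (1 + ‖p.1‖ ^ 2) ^ e :=
  Continuous.rpow_const (by fun_prop) fun p => Or.inl (by positivity)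

theorem weight_mul_inv_japanese {E : Type*} [NormedAddCommGroup E] (x : E) (e : ℝ) :
    (1 + ‖x‖ ^ 2) ^ (e + 1 / 2) * (Real.sqrt (1 + ‖x‖ ^ 2))⁻¹ = (1 + ‖x‖ ^ 2) ^ e := by
  have h : 0 < 1 + ‖x‖ ^ 2 := by positivity
  rw [Real.sqrt_eq_rpow, ← Real.rpow_neg h.le, ← Real.rpow_add h]
  congr 1; ring

/-- Pointwise form of the trace inequality along the rescaled slices. -/
theorem weight_mul_norm_sq_le_intervalIntegral {m : ℕ}
    {u : EuclideanSpace ℝ (Fin m) × ℝ → ℝ} (hu : ContDiff ℝ (⊤ : ℕ∞) u)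
    {a τ η L : ℝ} (ha : 0 ≤ a) (hL : 0 < L) (haL : a * L ≤ 1) (hη : |η| = 1)
    (hτ : ∀ s, 0 ≤ s → s ≤ L → |τ - η * s| ≤ 1) (e : ℝ) (j : ℕ)
    (x : EuclideanSpace ℝ (Fin m)) :
    (1 + ‖x‖ ^ 2) ^ e * ‖iteratedFDeriv ℝ j u (x, τ * Real.sqrt (1 + ‖x‖ ^ 2))‖ ^ 2 ≤
      ∫ s in (0 : ℝ)..L, 4 ^ |e| * (2 / L + 2 * L * (2 + a) ^ 2) *
        ((1 + ‖(1 + a * s) • x‖ ^ 2) ^ e * ‖iteratedFDeriv ℝ j u ((1 + a * s) • x,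
          (τ - η * s) * Real.sqrt (1 + ‖(1 + a * s) • x‖ ^ 2))‖ ^ 2 +
        (1 + ‖(1 + a * s) • x‖ ^ 2) ^ (e + 1) * ‖iteratedFDeriv ℝ (j + 1) u ((1 + a * s) • x,
          (τ - η * s) * Real.sqrt (1 + ‖(1 + a * s) • x‖ ^ 2))‖ ^ 2) := by
  have hDc : ∀ k : ℕ, Continuous (iteratedFDeriv ℝ k u) := fun k =>
    hu.continuous_iteratedFDeriv (by exact_mod_cast le_top)
  have hDj : ContDiff ℝ 1 (iteratedFDeriv ℝ j u) :=
    hu.iteratedFDeriv_right (by exact_mod_cast le_top)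
  set Φ : ℝ → EuclideanSpace ℝ (Fin m) × ℝ := fun s => ((1 + a * s) • x,
    (τ - η * s) * Real.sqrt (1 + ‖(1 + a * s) • x‖ ^ 2)) with hΦ
  have hΦc : Continuous Φ := by fun_prop
  set Φ' : ℝ → EuclideanSpace ℝ (Fin m) × ℝ := fun s =>
    (a • x, -η * Real.sqrt (1 + ‖(1 + a * s) • x‖ ^ 2) + (τ - η * s) *
        (a * ((1 + a * s) * ‖x‖ ^ 2) / Real.sqrt (1 + ‖(1 + a * s) • x‖ ^ 2)))
  have hΦ'c : Continuous Φ' := by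
    refine continuous_const.prodMk (Continuous.add (by fun_prop) (Continuous.mul (by fun_prop)
      (Continuous.div (by fun_prop) (by fun_prop) fun s =>
        (zero_lt_one.trans_le (one_le_japanese _)).ne')))
  have hder : ∀ s, HasDerivAt (fun s => iteratedFDeriv ℝ j u (Φ s))
      (fderiv ℝ (iteratedFDeriv ℝ j u) (Φ s) (Φ' s)) s := fun s =>
    ((hDj.differentiable (by simp)) (Φ s)).hasFDerivAt.comp_hasDerivAt s
      (hasDerivAt_rescaled_slice x a τ η s)
  have htr := norm_sq_le_intervalIntegral hL hder
    (((hDj.continuous_fderiv (by simp)).comp hΦc).clm_apply hΦ'c)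
  have hΦ0 : Φ 0 = (x, τ * Real.sqrt (1 + ‖x‖ ^ 2)) := by simp [Φ]
  rw [hΦ0] at htr
  have hfc : Continuous fun s => ‖fderiv ℝ (iteratedFDeriv ℝ j u) (Φ s) (Φ' s)‖ ^ 2 :=
    (((hDj.continuous_fderiv (by simp)).comp hΦc).clm_apply hΦ'c).norm.pow 2
  have hgc : ∀ k : ℕ, Continuous fun s => ‖iteratedFDeriv ℝ k u (Φ s)‖ ^ 2 := fun k =>
    ((hDc k).comp hΦc).norm.pow 2
  have hwc : ∀ r : ℝ, Continuous fun s => (1 + ‖(1 + a * s) • x‖ ^ 2) ^ r := fun r =>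
    (continuous_weight r).comp hΦc
  have hW : 0 < 1 + ‖x‖ ^ 2 := by positivity
  refine (mul_le_mul_of_nonneg_left htr (by positivity)).trans ?_
  rw [← intervalIntegral.integral_const_mul]
  refine intervalIntegral.integral_mono_on hL.le
    (Continuous.intervalIntegrable (by fun_prop) _ _)
    (Continuous.intervalIntegrable (continuous_const.mul
      (((hwc _).mul (hgc _)).add ((hwc _).mul (hgc _)))) _ _) fun s hs => ?_
  have has : a * s ≤ 1 := (mul_le_mul_of_nonneg_left hs.2 ha).trans haL
  have hc : 1 ≤ 1 + a * s := le_add_of_nonneg_right (mul_nonneg ha hs.1)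
  have hnorm : ‖(1 + a * s) • x‖ = (1 + a * s) * ‖x‖ := by
    rw [norm_smul, Real.norm_of_nonneg (by linarith)]
  have hle : ‖x‖ ≤ ‖(1 + a * s) • x‖ := by
    rw [hnorm]; exact le_mul_of_one_le_left (norm_nonneg _) hc
  have hle2 : ‖(1 + a * s) • x‖ ≤ 2 * ‖x‖ := by rw [hnorm]; gcongr; linarith
  have hWW : 1 + ‖x‖ ^ 2 ≤ 1 + ‖(1 + a * s) • x‖ ^ 2 := by gcongr
  have hWW' : 1 + ‖(1 + a * s) • x‖ ^ 2 ≤ 4 * (1 + ‖x‖ ^ 2) := by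
    have := pow_le_pow_left₀ (norm_nonneg _) hle2 2
    linarith
  have hwe := rpow_le_four_rpow_mul hW hWW hWW' e
  set W' := 1 + ‖(1 + a * s) • x‖ ^ 2
  have hW' : 0 < W' := hW.trans_le hWW
  have hd : ‖fderiv ℝ (iteratedFDeriv ℝ j u) (Φ s) (Φ' s)‖ ^ 2 ≤
      (2 + a) ^ 2 * W' * ‖iteratedFDeriv ℝ (j + 1) u (Φ s)‖ ^ 2 := by
    have h1 := (fderiv ℝ (iteratedFDeriv ℝ j u) (Φ s)).le_opNorm (Φ' s)
    rw [norm_fderiv_iteratedFDeriv] at h1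
    have h2 : ‖Φ' s‖ ≤ (2 + a) * Real.sqrt (1 + ‖x‖ ^ 2) :=
      norm_deriv_rescaled_slice_le x ha hs.1 has hη (hτ s hs.1 hs.2)
    calc _ ≤ (‖iteratedFDeriv ℝ (j + 1) u (Φ s)‖ *
            ((2 + a) * Real.sqrt (1 + ‖x‖ ^ 2))) ^ 2 := by
          gcongr
          exact h1.trans (by gcongr)
      _ = (2 + a) ^ 2 * (1 + ‖x‖ ^ 2) * ‖iteratedFDeriv ℝ (j + 1) u (Φ s)‖ ^ 2 := by
          rw [mul_pow, mul_pow, Real.sq_sqrt hW.le]; ring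
      _ ≤ _ := by gcongr
  rw [Real.rpow_add_one hW'.ne']
  set P := ‖iteratedFDeriv ℝ j u (Φ s)‖ ^ 2
  set Q := ‖iteratedFDeriv ℝ (j + 1) u (Φ s)‖ ^ 2
  have hP : 0 ≤ P := sq_nonneg _
  have hQ : 0 ≤ Q := sq_nonneg _
  calc (1 + ‖x‖ ^ 2) ^ e * (2 / L * P + 2 * L * _)
      ≤ (4 ^ |e| * W' ^ e) * (2 / L * P + 2 * L * ((2 + a) ^ 2 * W' * Q)) := by gcongr
    _ ≤ (4 ^ |e| * W' ^ e) * ((2 / L + 2 * L * (2 + a) ^ 2) * (P + W' * Q)) := by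
        gcongr
        have h1 : 0 ≤ 2 / L * (W' * Q) := by positivity
        have h2 : 0 ≤ 2 * L * (2 + a) ^ 2 * P := by positivity
        linarith
    _ = _ := by ring

/-- Weighted trace estimate for the full `j`-th derivative, uniform in the slice. -/
theorem exists_lintegral_trace_le (m : ℕ) {θ lam R : ℝ} (hθ : 0 < θ) (hθ1 : θ ≤ 1)
    (hlam : 0 < lam) (hR : 0 < R) (δ : ℝ) (j : ℕ) :
    ∃ C : NNReal, ∀ τ ∈ Set.Ioo (-θ) θ, ∀ u : EuclideanSpace ℝ (Fin m) × ℝ → ℝ,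
      ContDiff ℝ (⊤ : ℕ∞) u →
      ∫⁻ x in endSlice m lam R τ, ENNReal.ofReal ((1 + ‖x‖ ^ 2) ^ (δ + 1 / 2 + j) *
          ‖iteratedFDeriv ℝ j u (x, τ * Real.sqrt (1 + ‖x‖ ^ 2))‖ ^ 2) ≤
        C * ((∫⁻ p in boostEnd m θ lam R, ENNReal.ofReal
              ((1 + ‖p.1‖ ^ 2) ^ (δ + (j : ℝ)) * ‖iteratedFDeriv ℝ j u p‖ ^ 2)) +
            ∫⁻ p in boostEnd m θ lam R, ENNReal.ofReal
              ((1 + ‖p.1‖ ^ 2) ^ (δ + ((j + 1 : ℕ) : ℝ)) *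
                ‖iteratedFDeriv ℝ (j + 1) u p‖ ^ 2)) := by
  set a : ℝ := 2 * lam * (1 + 1 / R) with ha_def
  have ha : 0 < a := by positivity
  set L : ℝ := min (θ / 2) (1 / a)
  have hL : 0 < L := by positivity
  have haL : a * L ≤ 1 := by
    calc a * L ≤ a * (1 / a) := by gcongr; exact min_le_right _ _
      _ = 1 := by field_simp
  have hLθ : L ≤ θ / 2 := min_le_left _ _
  set e : ℝ := δ + 1 / 2 + j with he
  set K : ℝ := 4 ^ |e| * (2 / L + 2 * L * (2 + a) ^ 2) with hK
  have hK0 : 0 ≤ K := by positivity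
  refine ⟨K.toNNReal, fun τ hτ u hu => ?_⟩
  have hτ' : |τ| < θ := abs_lt.2 hτ
  obtain ⟨η, hη, hητ⟩ : ∃ η : ℝ, |η| = 1 ∧ ∀ s, |τ - η * s| = |(|τ| - s)| := by
    rcases le_total 0 τ with h | h
    · exact ⟨1, by simp, fun s => by rw [abs_of_nonneg h, one_mul]⟩
    · refine ⟨-1, by simp, fun s => ?_⟩
      rw [abs_of_nonpos h, ← abs_neg]
      congr 1; ring
  have hτs : ∀ s, 0 ≤ s → s ≤ L → |τ - η * s| ≤ 1 := fun s h0 h1 => by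
    rw [hητ, abs_le]
    constructor <;> linarith [abs_nonneg τ]
  have hDc : ∀ k : ℕ, Continuous (iteratedFDeriv ℝ k u) := fun k =>
    hu.continuous_iteratedFDeriv (by exact_mod_cast le_top)
  set F : EuclideanSpace ℝ (Fin m) × ℝ → ℝ := fun p =>
    (1 + ‖p.1‖ ^ 2) ^ e * ‖iteratedFDeriv ℝ j u p‖ ^ 2 +
      (1 + ‖p.1‖ ^ 2) ^ (e + 1) * ‖iteratedFDeriv ℝ (j + 1) u p‖ ^ 2 with hF
  have hterm : ∀ (r : ℝ) (k : ℕ),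
      Continuous fun p => (1 + ‖p.1‖ ^ 2) ^ r * ‖iteratedFDeriv ℝ k u p‖ ^ 2 := fun r k =>
    (continuous_weight r).mul ((hDc k).norm.pow 2)
  have hFc : Continuous F := (hterm _ _).add (hterm _ _)
  have hF0 : ∀ p, 0 ≤ F p := fun p => by positivity
  set V := boostEnd m θ lam R
  have hV : MeasurableSet V := measurableSet_boostEnd m θ lam R
  set G := V.indicator fun p => ENNReal.ofReal (F p)
  have hG : Measurable G := (ENNReal.measurable_ofReal.comp hFc.measurable).indicator hV
  have hpt : ∀ x ∈ endSlice m lam R τ, ENNReal.ofReal ((1 + ‖x‖ ^ 2) ^ e *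
      ‖iteratedFDeriv ℝ j u (x, τ * Real.sqrt (1 + ‖x‖ ^ 2))‖ ^ 2) ≤
      ENNReal.ofReal K * ∫⁻ s in Set.Ioc 0 L,
        G ((1 + a * s) • x, (τ - η * s) * Real.sqrt (1 + ‖(1 + a * s) • x‖ ^ 2)) := by
    intro x hx
    refine (ENNReal.ofReal_le_ofReal (weight_mul_norm_sq_le_intervalIntegral hu ha.le hL haL hη
      hτs e j x)).trans ?_
    have hcomp : Continuous fun s : ℝ => K * F ((1 + a * s) • x,
        (τ - η * s) * Real.sqrt (1 + ‖(1 + a * s) • x‖ ^ 2)) :=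
      continuous_const.mul (hFc.comp (by fun_prop))
    rw [intervalIntegral.integral_of_le hL.le, ofReal_integral_eq_lintegral_ofReal
      (hcomp.integrableOn_Ioc) (Filter.Eventually.of_forall fun s => mul_nonneg hK0 (hF0 _)),
      ← lintegral_const_mul' _ _ ENNReal.ofReal_ne_top]
    refine setLIntegral_mono' measurableSet_Ioc fun s hs => ?_
    have hmem : ((1 + a * s) • x, (τ - η * s) * Real.sqrt (1 + ‖(1 + a * s) • x‖ ^ 2)) ∈ V :=
      rescaled_slice_mem_boostEnd hlam hR hτ' (hητ s) hs.1 (by linarith [hs.2])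
        ((mul_le_mul_of_nonneg_left hs.2 ha.le).trans haL) hx
    simp only [G]
    rw [Set.indicator_of_mem hmem, ← ENNReal.ofReal_mul hK0]
  calc _ ≤ ∫⁻ x in endSlice m lam R τ, ENNReal.ofReal K * ∫⁻ s in Set.Ioc 0 L,
        G ((1 + a * s) • x, (τ - η * s) * Real.sqrt (1 + ‖(1 + a * s) • x‖ ^ 2)) :=
        setLIntegral_mono' (measurableSet_endSlice m lam R τ) hpt
    _ ≤ ∫⁻ x, ENNReal.ofReal K * ∫⁻ s in Set.Ioc 0 L,
        G ((1 + a * s) • x, (τ - η * s) * Real.sqrt (1 + ‖(1 + a * s) • x‖ ^ 2)) :=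
        setLIntegral_le_lintegral _ _
    _ ≤ ENNReal.ofReal K * ∫⁻ p, G p * ENNReal.ofReal (Real.sqrt (1 + ‖p.1‖ ^ 2))⁻¹ := by
        rw [lintegral_const_mul' _ _ ENNReal.ofReal_ne_top]
        gcongr
        exact lintegral_rescaled_slices_le hG ha.le hη
    _ = _ := by
        have hmeas : Measurable fun p => ENNReal.ofReal
            ((1 + ‖p.1‖ ^ 2) ^ (δ + (j : ℝ)) * ‖iteratedFDeriv ℝ j u p‖ ^ 2) :=
          ENNReal.measurable_ofReal.comp (hterm _ j).measurable
        rw [← lintegral_add_left hmeas,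
          ← lintegral_indicator hV]
        congr 1
        refine lintegral_congr fun p => ?_
        by_cases hp : p ∈ V
        · simp only [G]
          rw [Set.indicator_of_mem hp, Set.indicator_of_mem hp, ← ENNReal.ofReal_mul (hF0 p),
            ← ENNReal.ofReal_add (by positivity) (by positivity)]
          congr 1
          have h1 := weight_mul_inv_japanese p.1 (δ + (j : ℝ))
          have h2 := weight_mul_inv_japanese p.1 (δ + ((j + 1 : ℕ) : ℝ))
          rw [← h1, ← h2, hF, he]
          push_cast
          ring_nf
        · simp [G, hp]

/-- Weighted squared form of the chain rule estimate for time derivatives on a slice. -/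
theorem exists_weight_mul_norm_sq_slice_le (m : ℕ) (e : ℝ) (k l : ℕ) :
    ∃ C : ℝ, 0 ≤ C ∧ ∀ τ : ℝ, |τ| ≤ 1 → ∀ u : EuclideanSpace ℝ (Fin m) × ℝ → ℝ,
      ContDiff ℝ (⊤ : ℕ∞) u → ∀ x : EuclideanSpace ℝ (Fin m),
      (1 + ‖x‖ ^ 2) ^ (e + k + l) * ‖iteratedFDeriv ℝ l
          (fun x => (timeDeriv^[k] u) (x, τ * Real.sqrt (1 + ‖x‖ ^ 2))) x‖ ^ 2 ≤
        C * ∑ i ∈ Finset.range (l + 1), (1 + ‖x‖ ^ 2) ^ (e + ((i + k : ℕ) : ℝ)) *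
          ‖iteratedFDeriv ℝ (i + k) u (x, τ * Real.sqrt (1 + ‖x‖ ^ 2))‖ ^ 2 := by
  obtain ⟨A, hA0, hA⟩ := exists_norm_iteratedFDeriv_graph_le (EuclideanSpace ℝ (Fin m)) l
  refine ⟨A ^ 2 * (l + 1), by positivity, fun τ hτ u hu x => ?_⟩
  obtain ⟨hs, hb⟩ := timeDeriv_iterate_spec u hu k
  have h := hA τ hτ _ hs x
  set p := (x, τ * Real.sqrt (1 + ‖x‖ ^ 2))
  set ρ := Real.sqrt (1 + ‖x‖ ^ 2) with hρdef
  have hρ : 0 < ρ := zero_lt_one.trans_le (one_le_japanese x)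
  have hW : 0 < 1 + ‖x‖ ^ 2 := by positivity
  have hρ2 : ρ ^ 2 = 1 + ‖x‖ ^ 2 := Real.sq_sqrt hW.le
  set W := 1 + ‖x‖ ^ 2
  have hsum : (∑ i ∈ Finset.range (l + 1),
      ρ ^ i * ‖iteratedFDeriv ℝ i ((timeDeriv (m := m))^[k] u) p‖) ^ 2 ≤
      (l + 1) * ∑ i ∈ Finset.range (l + 1), W ^ i * ‖iteratedFDeriv ℝ (i + k) u p‖ ^ 2 := by
    refine sq_sum_le_card_mul_sum_sq.trans ?_
    rw [Finset.card_range]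
    push_cast
    gcongr with i hi
    rw [mul_pow, ← pow_mul, mul_comm i 2, pow_mul, hρ2]
    gcongr
    exact hb i p
  calc W ^ (e + k + l) * ‖_‖ ^ 2
      ≤ W ^ (e + k + l) * (A * ρ⁻¹ ^ l * ∑ i ∈ Finset.range (l + 1),
          ρ ^ i * ‖iteratedFDeriv ℝ i ((timeDeriv (m := m))^[k] u) p‖) ^ 2 := by gcongr
    _ = W ^ (e + k) * A ^ 2 * (∑ i ∈ Finset.range (l + 1),
          ρ ^ i * ‖iteratedFDeriv ℝ i ((timeDeriv (m := m))^[k] u) p‖) ^ 2 := by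
        rw [Real.rpow_add_natCast hW.ne', mul_pow, mul_pow, ← pow_mul, mul_comm l 2, pow_mul,
          inv_pow, hρ2, inv_pow]
        field_simp
    _ ≤ W ^ (e + k) * A ^ 2 * ((l + 1) * ∑ i ∈ Finset.range (l + 1),
          W ^ i * ‖iteratedFDeriv ℝ (i + k) u p‖ ^ 2) := by gcongr
    _ = _ := by
        rw [Finset.mul_sum, Finset.mul_sum, Finset.mul_sum]
        refine Finset.sum_congr rfl fun i _ => ?_
        have : e + ((i + k : ℕ) : ℝ) = e + k + i := by push_cast; ring
        rw [this, Real.rpow_add_natCast hW.ne' (e + k) i]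
        ring

theorem exists_lintegral_slice_le (m : ℕ) {θ lam R : ℝ} (hθ : 0 < θ) (hθ1 : θ ≤ 1)
    (hlam : 0 < lam) (hR : 0 < R) (δ : ℝ) (s k l : ℕ) (hkl : k + l ≤ s) :
    ∃ C : NNReal, ∀ τ ∈ Set.Ioo (-θ) θ, ∀ u : EuclideanSpace ℝ (Fin m) × ℝ → ℝ,
      ContDiff ℝ (⊤ : ℕ∞) u →
      ∫⁻ x in endSlice m lam R τ, ENNReal.ofReal ((1 + ‖x‖ ^ 2) ^ (δ + 1 / 2 + k + (l : ℝ)) *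
          ‖iteratedFDeriv ℝ l
            (fun x => (timeDeriv^[k] u) (x, τ * Real.sqrt (1 + ‖x‖ ^ 2))) x‖ ^ 2) ≤
        C * ∑ j ∈ Finset.range (s + 1 + 1), ∫⁻ p in boostEnd m θ lam R, ENNReal.ofReal
              ((1 + ‖p.1‖ ^ 2) ^ (δ + (j : ℝ)) * ‖iteratedFDeriv ℝ j u p‖ ^ 2) := by
  obtain ⟨A, hA0, hA⟩ := exists_weight_mul_norm_sq_slice_le m (δ + 1 / 2) k l
  choose B hB using exists_lintegral_trace_le m hθ hθ1 hlam hR δ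
  refine ⟨A.toNNReal * ∑ i ∈ Finset.range (l + 1), B (i + k) * 2, fun τ hτ u hu => ?_⟩
  have hτ1 : |τ| ≤ 1 := (abs_lt.2 hτ).le.trans hθ1
  set T : ℕ → EuclideanSpace ℝ (Fin m) → ℝ := fun j x =>
    (1 + ‖x‖ ^ 2) ^ (δ + 1 / 2 + (j : ℝ)) *
      ‖iteratedFDeriv ℝ j u (x, τ * Real.sqrt (1 + ‖x‖ ^ 2))‖ ^ 2 with hT
  set J : ℕ → ENNReal := fun j => ∫⁻ p in boostEnd m θ lam R, ENNReal.ofReal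
    ((1 + ‖p.1‖ ^ 2) ^ (δ + (j : ℝ)) * ‖iteratedFDeriv ℝ j u p‖ ^ 2)
  have hTm : ∀ j, Measurable fun x => ENNReal.ofReal (T j x) := fun j => by
    refine ENNReal.measurable_ofReal.comp (Continuous.measurable ?_)
    have h1 : Continuous fun x : EuclideanSpace ℝ (Fin m) =>
        (x, τ * Real.sqrt (1 + ‖x‖ ^ 2)) := by fun_prop
    exact ((continuous_weight _).comp h1).mul
      (((hu.continuous_iteratedFDeriv (by exact_mod_cast le_top)).comp h1).norm.pow 2)
  have hJ : ∀ j ≤ s + 1, J j ≤ ∑ j ∈ Finset.range (s + 1 + 1), J j := fun j hj =>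
    Finset.single_le_sum (f := J) (fun _ _ => zero_le) (Finset.mem_range.2 (by omega))
  calc _ ≤ ∫⁻ x in endSlice m lam R τ,
        ENNReal.ofReal A * ∑ i ∈ Finset.range (l + 1), ENNReal.ofReal (T (i + k) x) := by
        refine lintegral_mono fun x => ?_
        rw [← ENNReal.ofReal_sum_of_nonneg fun i _ => by positivity, ← ENNReal.ofReal_mul hA0]
        exact ENNReal.ofReal_le_ofReal (hA τ hτ1 u hu x)
    _ = ENNReal.ofReal A * ∑ i ∈ Finset.range (l + 1),
          ∫⁻ x in endSlice m lam R τ, ENNReal.ofReal (T (i + k) x) := by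
        rw [lintegral_const_mul' _ _ ENNReal.ofReal_ne_top,
          lintegral_finsetSum _ fun i _ => hTm (i + k)]
    _ ≤ ENNReal.ofReal A * ∑ i ∈ Finset.range (l + 1),
          (B (i + k) * 2 * ∑ j ∈ Finset.range (s + 1 + 1), J j) := by
        gcongr with i hi
        rw [Finset.mem_range] at hi
        refine (hB (i + k) τ hτ u hu).trans ?_
        rw [mul_assoc, two_mul]
        gcongr
        · exact hJ (i + k) (by omega)
        · exact hJ (i + k + 1) (by omega)
    _ = _ := by
        rw [← Finset.sum_mul, ENNReal.coe_mul, ENNReal.ofNNReal_finsetSum, mul_assoc]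
        simp only [ENNReal.coe_mul, ENNReal.coe_ofNat]
        rfl

theorem ENNReal.rpow_half_sq (S : ENNReal) : (S ^ (1 / 2 : ℝ)) ^ 2 = S := by
  rw [← ENNReal.rpow_natCast, ← ENNReal.rpow_mul]
  norm_num

/-- **Restriction (trace) lemma on a boost end**: for `n ≥ 2`, `θ ∈ (0,1/2]`, `λ ≥ 2`,
`R > 0`, `s ∈ ℕ`, `δ ∈ ℝ`, there is `C = C(n, θ, λ, R, s, δ)` such that for every
`τ ∈ (−θ, θ)` and every smooth `u` with finite `H_{s+1,δ}(V_{θ,λ})`-norm, the traces of the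
time derivatives on the slice satisfy
`Σ_{k=0}^{s} ‖x̄ ↦ (∂_t^k u)(x̄, τσ̄(x̄))‖²_{H_{s−k, δ+1/2+k}(E′_τ)} ≤ C ‖u‖²_{H_{s+1,δ}(V_{θ,λ})}`. -/
theorem weighted_sobolev_restriction_boost_end
    (n : ℕ) (hn : 2 ≤ n) (θ : ℝ) (hθ : θ ∈ Set.Ioc (0 : ℝ) (1/2))
    (lam R : ℝ) (hlam : 2 ≤ lam) (hR : 0 < R) (s : ℕ) (δ : ℝ) :
    ∃ C : ℝ, 0 < C ∧
      ∀ τ : ℝ, τ ∈ Set.Ioo (-θ) θ →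
      ∀ u : EuclideanSpace ℝ (Fin (n - 1)) × ℝ → ℝ, ContDiff ℝ (⊤ : ℕ∞) u →
        wSobOn (n - 1) (s + 1) δ (boostEnd (n - 1) θ lam R) u < ⊤ →
        ∑ k ∈ Finset.range (s + 1),
            (wSobE (n - 1) (s - k) (δ + 1/2 + k) (endSlice (n - 1) lam R τ)
              (fun x => (timeDeriv^[k] u) (x, τ * Real.sqrt (1 + ‖x‖ ^ 2)))) ^ 2
          ≤ ENNReal.ofReal C * (wSobOn (n - 1) (s + 1) δ (boostEnd (n - 1) θ lam R) u) ^ 2 := by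
  have hex : ∀ k l, ∃ C : NNReal, k + l ≤ s → ∀ τ ∈ Set.Ioo (-θ) θ,
      ∀ u : EuclideanSpace ℝ (Fin (n - 1)) × ℝ → ℝ, ContDiff ℝ (⊤ : ℕ∞) u →
      ∫⁻ x in endSlice (n - 1) lam R τ,
          ENNReal.ofReal ((1 + ‖x‖ ^ 2) ^ (δ + 1 / 2 + k + (l : ℝ)) * ‖iteratedFDeriv ℝ l
            (fun x => (timeDeriv^[k] u) (x, τ * Real.sqrt (1 + ‖x‖ ^ 2))) x‖ ^ 2) ≤
        C * ∑ j ∈ Finset.range (s + 1 + 1), ∫⁻ p in boostEnd (n - 1) θ lam R, ENNReal.ofReal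
              ((1 + ‖p.1‖ ^ 2) ^ (δ + (j : ℝ)) * ‖iteratedFDeriv ℝ j u p‖ ^ 2) := by
    intro k l
    by_cases hkl : k + l ≤ s
    · obtain ⟨C, hC⟩ := exists_lintegral_slice_le (n - 1) hθ.1 (hθ.2.trans (by norm_num))
        (by linarith : 0 < lam) hR δ s k l hkl
      exact ⟨C, fun _ => hC⟩
    · exact ⟨0, fun h => absurd h hkl⟩
  choose B hB using hex
  set D : NNReal := ∑ k ∈ Finset.range (s + 1), ∑ l ∈ Finset.range (s - k + 1), B k l with hD
  refine ⟨(D + 1 : NNReal), by positivity, fun τ hτ u hu _ => ?_⟩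
  simp only [wSobE, wSobOn, ENNReal.rpow_half_sq, ENNReal.ofReal_coe_nnreal]
  refine le_trans ?_ (mul_le_mul_left (ENNReal.coe_le_coe.2 (le_add_of_nonneg_right zero_le_one)) _)
  rw [hD, ENNReal.ofNNReal_finsetSum, Finset.sum_mul]
  refine Finset.sum_le_sum fun k hk => ?_
  rw [ENNReal.ofNNReal_finsetSum, Finset.sum_mul]
  refine Finset.sum_le_sum fun l hl => ?_
  rw [Finset.mem_range] at hk hl
  exact hB k l (by omega) τ hτ u hu
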